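/- For every integer n ≥ 1, the number of increasing 1,2-trees on the vertex set {1,…,n} equals the number of labeled trees (Cayley trees) on the vertex set {1,…,n}. -/

import Mathlib

open SimpleGraph

/-- The set of neighbors of `v` having a smaller label. -/
def lowerNbrs {n : ℕ} (G : SimpleGraph (Fin n)) (v : Fin n) : Set (Fin n) :=
  {x | G.Adj v x ∧ x < v}

/-- `G` is an increasing 1,2-tree: every vertex other than the first one has a nonempty
set of smaller neighbors, of cardinality at most 2, forming a clique. -/
def IsIncreasing12Tree {n : ℕ} (G : SimpleGraph (Fin n)) : Prop :=
  ∀ v : Fin n, 1 ≤ v.val →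
    (lowerNbrs G v).Nonempty ∧ (lowerNbrs G v).ncard ≤ 2 ∧
      ∀ x ∈ lowerNbrs G v, ∀ y ∈ lowerNbrs G v, x ≠ y → G.Adj x y

/-- The set of vertices reachable from `v` after deleting the edge `{u,v}`
(in a tree, the vertex set of the subtree rooted at `v` when `v` is the child endpoint). -/
def subtreeSet {n : ℕ} (G : SimpleGraph (Fin n)) (u v : Fin n) : Set (Fin n) :=
  {w | (G.deleteEdges {s(u, v)}).Reachable v w}

/-- `v` is the child endpoint of the edge `{u,v}`: after deleting this edge,
`v` is no longer reachable from the root. -/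
def IsChild {n : ℕ} (G : SimpleGraph (Fin n)) (root u v : Fin n) : Prop :=
  G.Adj u v ∧ ¬ (G.deleteEdges {s(u, v)}).Reachable root v

/-- The minimal label occurring in a set of vertices (labels being `Fin.val`). -/
noncomputable def minLabel {n : ℕ} (S : Set (Fin n)) : ℕ := sInf (Fin.val '' S)

/-- An edge `{u,v}` with child endpoint `v` is a twist if the minimal label in the
subtree rooted at `v` is smaller than the label of `u`. -/
def IsTwist {n : ℕ} (G : SimpleGraph (Fin n)) (root : Fin n) (e : Sym2 (Fin n)) : Prop :=
  ∃ u v : Fin n, e = s(u, v) ∧ IsChild G root u v ∧ minLabel (subtreeSet G u v) < u.val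

/-- An edge `{u,v}` with child endpoint `v` is increasing if the label of `u` is smaller
than every label in the subtree rooted at `v`. -/
def IsIncreasingEdge {n : ℕ} (G : SimpleGraph (Fin n)) (root : Fin n) (e : Sym2 (Fin n)) : Prop :=
  ∃ u v : Fin n, e = s(u, v) ∧ IsChild G root u v ∧ u.val < minLabel (subtreeSet G u v)

/-- The number of twists of `G` (with respect to the given root). -/
noncomputable def numTwists {n : ℕ} (G : SimpleGraph (Fin n)) (root : Fin n) : ℕ :=
  Nat.card {e : Sym2 (Fin n) // e ∈ G.edgeSet ∧ IsTwist G root e}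

/-- The number of increasing 1,2-trees on `n` vertices with `m` edges. -/
noncomputable def numInc12Trees (n m : ℕ) : ℕ :=
  Nat.card {G : SimpleGraph (Fin n) // IsIncreasing12Tree G ∧ G.edgeSet.ncard = m}

/-- The number of Cayley trees on `n ≥ 1` vertices (rooted at the vertex with label 1)
with exactly `j` twists. -/
noncomputable def numCayleyTwist (n j : ℕ) (h : 0 < n) : ℕ :=
  Nat.card {G : SimpleGraph (Fin n) // G.IsTree ∧ numTwists G ⟨0, h⟩ = j}

section ParentFunctions

/-- `f` assigns to every vertex outside the root set `S` a parent, in such a way that iterating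
`f` always ends in `S`. -/
def IsParentFunction {V : Type*} (S : Finset V) (f : {v // v ∉ S} → V) : Prop :=
  WellFounded fun b a : {v // v ∉ S} => f a = b

open Classical in
/-- The set of vertices whose parent is a root. -/
noncomputable def rootChildren {V : Type*} [Fintype V] (S : Finset V) (f : {v // v ∉ S} → V) :
    Finset {v // v ∉ S} :=
  Finset.univ.filter fun v => f v ∈ S

lemma mem_rootChildren {V : Type*} [Fintype V] {S : Finset V} {f : {v // v ∉ S} → V}
    {v : {v // v ∉ S}} : v ∈ rootChildren S f ↔ f v ∈ S := by
  simp [rootChildren]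

lemma rootChildren_eq_iff {V : Type*} [Fintype V] {S : Finset V} {f : {v // v ∉ S} → V}
    {T : Finset {v // v ∉ S}} : rootChildren S f = T ↔ ∀ v, f v ∈ S ↔ v ∈ T := by
  simp [Finset.ext_iff, mem_rootChildren]

/-- Deleting the roots and making the children of the roots the new roots preserves being a
parent function. -/
lemma isParentFunction_iff_restrict {V : Type*} {S : Finset V} (f : {v // v ∉ S} → V)
    (T : Finset {v // v ∉ S}) (hT : ∀ v, f v ∈ S ↔ v ∈ T) (g : {v // v ∉ T} → {v // v ∉ S})
    (hg : ∀ v, (g v : V) = f v) : IsParentFunction S f ↔ IsParentFunction T g := by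
  constructor
  · intro h
    refine Subrelation.wf ?_ (InvImage.wf (Subtype.val : {v // v ∉ T} → _) h)
    intro b a hab
    change f a = _
    rw [← hg, hab]
  · intro h
    have hroot : ∀ v ∈ T, Acc (fun b a : {v // v ∉ S} => f a = b) v := by
      intro v hv
      refine ⟨_, fun b hb => absurd ((hT v).2 hv) ?_⟩
      rw [hb]
      exact b.2
    refine ⟨fun v => ?_⟩
    by_cases hv : v ∈ T
    · exact hroot v hv
    · suffices ∀ w : {v // v ∉ T}, Acc (fun b a : {v // v ∉ S} => f a = b) w from this ⟨v, hv⟩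
      intro w
      induction w using h.induction with
      | _ w ih =>
        refine ⟨_, fun b hb => ?_⟩
        by_cases hbT : b ∈ T
        · exact hroot b hbT
        · exact ih ⟨b, hbT⟩ (Subtype.ext (by rw [hg, hb]))

open Classical in
/-- A parent function for which `T` is the set of children of roots amounts to a map from `T` to
the roots together with a parent function on the non-roots, rooted at `T`. -/
noncomputable def parentFunctionFiberEquiv {V : Type*} [Fintype V] (S : Finset V)
    (T : Finset {v // v ∉ S}) :
    {f : {f : {v // v ∉ S} → V // IsParentFunction S f} // rootChildren S f.1 = T} ≃
      ({v // v ∈ T} → {v // v ∈ S}) ×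
        {g : {v // v ∉ T} → {v // v ∉ S} // IsParentFunction T g} where
  toFun f := (fun v => ⟨f.1.1 v, (rootChildren_eq_iff.1 f.2 v).2 v.2⟩,
    ⟨fun v => ⟨f.1.1 v, fun h => v.2 ((rootChildren_eq_iff.1 f.2 v).1 h)⟩,
      (isParentFunction_iff_restrict _ T (rootChildren_eq_iff.1 f.2) _ fun _ => rfl).1 f.1.2⟩)
  invFun p :=
    have hT : ∀ v : {v // v ∉ S},
        (if h : v ∈ T then (p.1 ⟨v, h⟩ : V) else p.2.1 ⟨v, h⟩) ∈ S ↔ v ∈ T := by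
      intro v
      by_cases h : v ∈ T
      · simp [h]
      · simp only [h, dite_false, iff_false]
        exact (p.2.1 ⟨v, h⟩).2
    ⟨⟨fun v => if h : v ∈ T then p.1 ⟨v, h⟩ else p.2.1 ⟨v, h⟩,
      (isParentFunction_iff_restrict _ T hT p.2.1 fun v => by simp [v.2]).2 p.2.2⟩,
      rootChildren_eq_iff.2 hT⟩
  left_inv f := by
    apply Subtype.ext
    apply Subtype.ext
    funext v
    simp
  right_inv p := by
    refine Prod.ext ?_ (Subtype.ext ?_) <;> funext v <;> apply Subtype.ext <;> simp [v.2]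

lemma card_parentFunction_eq_sum {V : Type*} [Fintype V] [DecidableEq V] (S : Finset V) :
    Nat.card {f : {v // v ∉ S} → V // IsParentFunction S f} =
      ∑ T : Finset {v // v ∉ S}, S.card ^ T.card *
        Nat.card {g : {v // v ∉ T} → {v // v ∉ S} // IsParentFunction T g} := by
  rw [← Nat.card_congr (Equiv.sigmaFiberEquiv fun f :
    {f : {v // v ∉ S} → V // IsParentFunction S f} => rootChildren S f.1), Nat.card_sigma]
  refine Finset.sum_congr rfl fun T _ => ?_
  rw [Nat.card_congr (parentFunctionFiberEquiv S T), Nat.card_prod, Nat.card_fun]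
  simp

lemma sum_choose_mul_pow_mul_pow (m k : ℕ) :
    ∑ i ∈ Finset.range (m + 1 + 1), (m + 1).choose i * (k ^ i * (i * (m + 1) ^ (m + 1 - i))) =
      (m + 1) * (k * (m + 1 + k) ^ m) := by
  rw [Finset.sum_range_succ', add_comm (m + 1) k, add_pow k (m + 1) m, Finset.mul_sum, Finset.mul_sum]
  simp only [zero_mul, mul_zero, add_zero]
  refine Finset.sum_congr rfl fun i _ => ?_
  rw [Nat.add_sub_add_right, pow_succ]
  have h := Nat.add_one_mul_choose_eq m i
  zify at h ⊢
  linear_combination -(k : ℤ) ^ i * k * (m + 1) ^ (m - i) * h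

/-- The number of rooted forests on `V` with root set `S`. -/
theorem card_parentFunction_mul_card {V : Type*} [Fintype V] [DecidableEq V] (S : Finset V) :
    Nat.card {f : {v // v ∉ S} → V // IsParentFunction S f} * Fintype.card V =
      S.card * Fintype.card V ^ Fintype.card {v // v ∉ S} := by
  induction hn : Fintype.card V using Nat.strong_induction_on generalizing V with
  | _ n ih =>
    subst hn
    have hV : Fintype.card {v // v ∉ S} + S.card = Fintype.card V := by
      rw [Fintype.card_subtype_compl]
      simp [Finset.card_le_univ]
    obtain rfl | hS := S.eq_empty_or_nonempty
    · obtain hVe | ⟨⟨v⟩⟩ := isEmpty_or_nonempty V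
      · simp
      · have : IsEmpty {f : {v // v ∉ (∅ : Finset V)} → V // IsParentFunction ∅ f} := by
          refine ⟨fun ⟨f, hf⟩ => ?_⟩
          have : ∀ _ : {v // v ∉ (∅ : Finset V)}, False := fun v => by
            induction v using hf.induction with
            | _ v ih => exact ih ⟨f v, by simp⟩ rfl
          exact this ⟨v, by simp⟩
        simp
    · have hk := hS.card_pos
      obtain hm | ⟨m, hm⟩ : Fintype.card {v // v ∉ S} = 0 ∨
          ∃ m, Fintype.card {v // v ∉ S} = m + 1 := by
        cases Fintype.card {v // v ∉ S} <;> simp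
      · have : IsEmpty {v // v ∉ S} := Fintype.card_eq_zero_iff.1 hm
        have hc : Nat.card {f : {v // v ∉ S} → V // IsParentFunction S f} = 1 := by
          rw [Nat.card_eq_one_iff_unique]
          exact ⟨inferInstance, ⟨⟨fun v => isEmptyElim v, ⟨fun v => isEmptyElim v⟩⟩⟩⟩
        rw [hc, hm, ← hV, hm]
        ring
      · have key : (m + 1) * Nat.card {f : {v // v ∉ S} → V // IsParentFunction S f} =
            (m + 1) * (S.card * (m + 1 + S.card) ^ m) := by
          rw [card_parentFunction_eq_sum, Finset.mul_sum, ← sum_choose_mul_pow_mul_pow,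
            ← Finset.powerset_univ]
          rw [← hm, ← Finset.card_univ]
          simp only [← smul_eq_mul (a := Nat.choose _ _)]
          rw [← Finset.sum_powerset_apply_card
            (fun i => S.card ^ i * (i * (Finset.univ : Finset {v // v ∉ S}).card ^
              ((Finset.univ : Finset {v // v ∉ S}).card - i)))]
          refine Finset.sum_congr rfl fun T _ => ?_
          have h := ih (Fintype.card {v // v ∉ S}) (by omega) T rfl
          have hT : Fintype.card {v // v ∉ T} = Fintype.card {v // v ∉ S} - T.card := by
            rw [Fintype.card_subtype_compl, Fintype.card_coe]
          rw [hT] at h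
          rw [Finset.card_univ, ← h]
          ring
        rw [Nat.eq_of_mul_eq_mul_left m.succ_pos key, hm, ← hV, hm]
        ring

end ParentFunctions

section Trees

/-- The graph joining every non-root vertex to its parent. -/
def parentGraph {V : Type*} {S : Finset V} (f : {v // v ∉ S} → V) : SimpleGraph V :=
  SimpleGraph.fromRel fun x y => ∃ h : x ∉ S, f ⟨x, h⟩ = y

lemma IsParentFunction.apply_ne {V : Type*} {S : Finset V} {f : {v // v ∉ S} → V}
    (hf : IsParentFunction S f) (v : {v // v ∉ S}) : f v ≠ v :=
  fun h => hf.irrefl.irrefl v h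

lemma parentGraph_adj_apply {V : Type*} {S : Finset V} {f : {v // v ∉ S} → V}
    (hf : IsParentFunction S f) (v : {v // v ∉ S}) : (parentGraph f).Adj v (f v) := by
  rw [parentGraph, SimpleGraph.fromRel_adj]
  exact ⟨(hf.apply_ne v).symm, Or.inl ⟨v.2, rfl⟩⟩

lemma parentGraph_connected {V : Type*} {r : V} {f : {v // v ∉ ({r} : Finset V)} → V}
    (hf : IsParentFunction {r} f) : (parentGraph f).Connected := by
  have hr : ∀ v, (parentGraph f).Reachable v r := by
    intro v
    by_cases hv : v ∈ ({r} : Finset V)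
    · rw [Finset.mem_singleton.1 hv]
    · suffices ∀ w : {v // v ∉ ({r} : Finset V)}, (parentGraph f).Reachable w r from
        this ⟨v, hv⟩
      intro w
      induction w using hf.induction with
      | _ w ih =>
        refine (parentGraph_adj_apply hf w).reachable.trans ?_
        by_cases hw : f w ∈ ({r} : Finset V)
        · rw [Finset.mem_singleton.1 hw]
        · exact ih ⟨f w, hw⟩ rfl
  exact { preconnected := fun u v => (hr u).trans (hr v).symm, nonempty := ⟨r⟩ }

lemma parentGraph_isTree {V : Type*} [Finite V] {r : V}
    {f : {v // v ∉ ({r} : Finset V)} → V} (hf : IsParentFunction {r} f) :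
    (parentGraph f).IsTree := by
  classical
  have := Fintype.ofFinite V
  have hc := parentGraph_connected hf
  rw [SimpleGraph.isTree_iff_connected_and_card]
  refine ⟨hc, le_antisymm ?_ hc.card_vert_le_card_edgeSet_add_one⟩
  have hsurj : Function.Surjective fun v : {v // v ∉ ({r} : Finset V)} =>
      (⟨s(v.1, f v), parentGraph_adj_apply hf v⟩ : (parentGraph f).edgeSet) := by
    rintro ⟨e, he⟩
    induction e with
    | _ x y =>
      rw [SimpleGraph.mem_edgeSet, parentGraph, SimpleGraph.fromRel_adj] at he
      obtain ⟨_, ⟨h, rfl⟩ | ⟨h, rfl⟩⟩ := he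
      · exact ⟨⟨x, h⟩, rfl⟩
      · exact ⟨⟨y, h⟩, Subtype.ext Sym2.eq_swap⟩
  have hle := Nat.card_le_card_of_surjective _ hsurj
  have hV : Nat.card {v // v ∉ ({r} : Finset V)} + 1 = Nat.card V := by
    rw [Nat.card_eq_fintype_card, Nat.card_eq_fintype_card, Fintype.card_subtype_compl]
    simp only [Fintype.card_coe, Finset.card_singleton]
    have := Fintype.card_pos_iff.2 ⟨r⟩
    omega
  change Nat.card (parentGraph f).edgeSet ≤ _ at hle
  omega

lemma parentGraph_injective {V : Type*} {S : Finset V} {f g : {v // v ∉ S} → V}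
    (hf : IsParentFunction S f) (h : parentGraph f = parentGraph g) : f = g := by
  funext v
  induction v using hf.induction with
  | _ v ih =>
    have hadj := parentGraph_adj_apply hf v
    rw [h, parentGraph, SimpleGraph.fromRel_adj] at hadj
    obtain ⟨_, ⟨_, hg⟩ | ⟨hv, hg⟩⟩ := hadj
    · exact hg.symm
    · have hfb : f ⟨f v, hv⟩ = v := (ih ⟨f v, hv⟩ rfl).trans hg
      exact absurd hfb (hf.asymmetric (a := ⟨f v, hv⟩) (b := v) rfl)

lemma exists_parentGraph_eq {V : Type*} {G : SimpleGraph V} (hG : G.IsTree) (r : V) :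
    ∃ f : {v // v ∉ ({r} : Finset V)} → V, IsParentFunction {r} f ∧ parentGraph f = G := by
  have hstep : ∀ v : {v // v ∉ ({r} : Finset V)}, ∃ w, G.Adj v w ∧ G.dist w r < G.dist v r := by
    rintro ⟨v, hv⟩
    obtain ⟨p, hp⟩ := hG.connected.exists_walk_length_eq_dist v r
    cases p with
    | nil => simp at hv
    | cons h q =>
      refine ⟨_, h, ?_⟩
      have := SimpleGraph.dist_le q
      rw [SimpleGraph.Walk.length_cons] at hp
      change _ < G.dist v r
      omega
  choose f hadj hdist using hstep
  have hf : IsParentFunction {r} f := by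
    refine Subrelation.wf ?_ (measure fun v : {v // v ∉ ({r} : Finset V)} => G.dist v r).wf
    intro b a hab
    change G.dist b r < G.dist a r
    rw [← hab]
    exact hdist a
  have hle : parentGraph f ≤ G := by
    intro x y hxy
    rw [parentGraph, SimpleGraph.fromRel_adj] at hxy
    obtain ⟨_, ⟨h, rfl⟩ | ⟨h, rfl⟩⟩ := hxy
    · exact hadj ⟨x, h⟩
    · exact (hadj ⟨y, h⟩).symm
  exact ⟨f, hf, le_antisymm hle
    ((SimpleGraph.isTree_iff_minimal_connected.1 hG).2 (parentGraph_connected hf) hle)⟩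

/-- **Cayley's formula**, in a form free of subtraction. -/
theorem card_trees_mul_card {V : Type*} [Fintype V] [Nonempty V] :
    Nat.card {G : SimpleGraph V // G.IsTree} * Fintype.card V =
      Fintype.card V ^ (Fintype.card V - 1) := by
  classical
  obtain ⟨r⟩ := ‹Nonempty V›
  have e : {f : {v // v ∉ ({r} : Finset V)} → V // IsParentFunction {r} f} ≃
      {G : SimpleGraph V // G.IsTree} :=
    Equiv.ofBijective (fun f => ⟨parentGraph f.1, parentGraph_isTree f.2⟩)
      ⟨fun f g h => Subtype.ext (parentGraph_injective f.2 (congrArg Subtype.val h)),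
        fun G => by
          obtain ⟨f, hf, h⟩ := exists_parentGraph_eq G.2 r
          exact ⟨⟨f, hf⟩, Subtype.ext h⟩⟩
  rw [← Nat.card_congr e, card_parentFunction_mul_card, Fintype.card_subtype_compl]
  simp

end Trees

section Extensions

/-- The number of ways to add `k` vertices one after the other to a graph with `n` vertices and
`m` edges, joining each new vertex either to a vertex or to both ends of an edge. -/
def numExtensions : ℕ → ℕ → ℕ → ℕ
  | 0, _, _ => 1
  | k + 1, n, m =>
    n * numExtensions k (n + 1) (m + 1) + m * numExtensions k (n + 1) (m + 2)

/-- The value `k! [t ^ k] exp (N t) (1 - t) ^ (-j)`, where `[t ^ k]` extracts a coefficient. -/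
def expGeomCoeff (N : ℤ) : ℕ → ℕ → ℤ
  | 0, _ => 1
  | k + 1, j => N * expGeomCoeff N k j + j * expGeomCoeff N k (j + 1)

lemma expGeomCoeff_sub (N : ℤ) (k j : ℕ) :
    expGeomCoeff N (k + 1) j =
      expGeomCoeff N (k + 1) (j + 1) - (k + 1) * expGeomCoeff N k (j + 1) := by
  induction k generalizing j with
  | zero =>
    simp only [expGeomCoeff]
    push_cast
    ring
  | succ k ih =>
    have h1 := ih j
    have h2 := ih (j + 1)
    have e1 : expGeomCoeff N (k + 1 + 1) j =
      N * expGeomCoeff N (k + 1) j + j * expGeomCoeff N (k + 1) (j + 1) := rfl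
    have e2 : expGeomCoeff N (k + 1 + 1) (j + 1) =
      N * expGeomCoeff N (k + 1) (j + 1) +
        (j + 1 : ℕ) * expGeomCoeff N (k + 1) (j + 1 + 1) := rfl
    have e3 : expGeomCoeff N (k + 1) (j + 1) =
      N * expGeomCoeff N k (j + 1) + (j + 1 : ℕ) * expGeomCoeff N k (j + 1 + 1) := rfl
    rw [e1, e2]
    push_cast at e3 ⊢
    linear_combination N * h1 + (j + 1) * h2 + (k + 1) * e3

lemma expGeomCoeff_zero (N : ℤ) (k : ℕ) : expGeomCoeff N k 0 = N ^ k := by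
  induction k with
  | zero => simp [expGeomCoeff]
  | succ k ih => simp [expGeomCoeff, ih, pow_succ, mul_comm]

lemma numExtensions_eq_expGeomCoeff (k n j : ℕ) :
    (numExtensions k n (j + 1) : ℤ) = expGeomCoeff (n + k) k j := by
  induction k generalizing n j with
  | zero => rfl
  | succ k ih =>
    have h1 := ih (n + 1) (j + 1)
    have h2 := ih (n + 1) (j + 2)
    have hN : ((n + 1 : ℕ) : ℤ) + k = n + (k + 1 : ℕ) := by push_cast; ring
    rw [hN] at h1 h2
    rw [expGeomCoeff_sub, numExtensions]
    have e : expGeomCoeff (n + (k + 1 : ℕ)) (k + 1) (j + 1) =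
      (n + (k + 1 : ℕ)) * expGeomCoeff (n + (k + 1 : ℕ)) k (j + 1) +
        (j + 1 : ℕ) * expGeomCoeff (n + (k + 1 : ℕ)) k (j + 2) := rfl
    rw [e]
    push_cast at h1 h2 ⊢
    rw [h1, h2]
    ring

lemma numExtensions_one (k n : ℕ) : numExtensions k n 1 = (n + k) ^ k := by
  have h := numExtensions_eq_expGeomCoeff k n 0
  rw [expGeomCoeff_zero] at h
  exact_mod_cast h

lemma numExtensions_one_zero_mul (k : ℕ) :
    numExtensions k 1 0 * (k + 1) = (k + 1) ^ k := by
  cases k with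
  | zero => rfl
  | succ k =>
    rw [numExtensions, numExtensions_one]
    ring

end Extensions

section IncreasingTrees

/-- The number of edges, counted by their larger endpoint. -/
noncomputable def numLowerNbrs {n : ℕ} (G : SimpleGraph (Fin n)) : ℕ :=
  ∑ v, (lowerNbrs G v).ncard

/-- The graph obtained from `H` by adding a new last vertex joined to the vertices in `s`. -/
def addLast {n : ℕ} (H : SimpleGraph (Fin n)) (s : Finset (Fin n)) :
    SimpleGraph (Fin (n + 1)) where
  Adj x y := Fin.lastCases (motive := fun _ => Prop)
    (Fin.lastCases (motive := fun _ => Prop) False (fun b => b ∈ s) y)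
    (fun a => Fin.lastCases (motive := fun _ => Prop) (a ∈ s) (fun b => H.Adj a b) y) x
  symm := ⟨fun x y => by
    induction x using Fin.lastCases <;> induction y using Fin.lastCases <;>
      simp [SimpleGraph.adj_comm]⟩
  loopless := ⟨fun x => by induction x using Fin.lastCases <;> simp⟩

variable {n : ℕ}

lemma mem_lowerNbrs {G : SimpleGraph (Fin n)} {v x : Fin n} :
    x ∈ lowerNbrs G v ↔ G.Adj v x ∧ x < v :=
  Iff.rfl

@[simp] lemma addLast_adj_castSucc (H : SimpleGraph (Fin n)) (s : Finset (Fin n)) (a b : Fin n) :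
    (addLast H s).Adj a.castSucc b.castSucc ↔ H.Adj a b := by
  simp [addLast]

@[simp] lemma addLast_adj_last (H : SimpleGraph (Fin n)) (s : Finset (Fin n)) (b : Fin n) :
    (addLast H s).Adj (Fin.last n) b.castSucc ↔ b ∈ s := by
  simp [addLast]

open Classical in
/-- A graph on `Fin (n + 1)` is a graph on `Fin n` together with the neighbors of the last
vertex. -/
noncomputable def addLastEquiv (n : ℕ) :
    SimpleGraph (Fin n) × Finset (Fin n) ≃ SimpleGraph (Fin (n + 1)) where
  toFun p := addLast p.1 p.2
  invFun G := (G.comap Fin.castSucc,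
    Finset.univ.filter fun b => G.Adj (Fin.last n) b.castSucc)
  left_inv p := by
    refine Prod.ext ?_ ?_
    · ext a b
      simp
    · ext b
      simp
  right_inv G := by
    ext x y
    induction x using Fin.lastCases <;> induction y using Fin.lastCases <;>
      simp [SimpleGraph.adj_comm, addLast]

lemma lowerNbrs_addLast_castSucc (H : SimpleGraph (Fin n)) (s : Finset (Fin n)) (v : Fin n) :
    lowerNbrs (addLast H s) v.castSucc = Fin.castSucc '' lowerNbrs H v := by
  ext x
  induction x using Fin.lastCases with
  | last => simp [lowerNbrs, Fin.le_last]
  | cast x => simp [lowerNbrs]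

lemma lowerNbrs_addLast_last (H : SimpleGraph (Fin n)) (s : Finset (Fin n)) :
    lowerNbrs (addLast H s) (Fin.last n) = Fin.castSucc '' (s : Set (Fin n)) := by
  ext x
  induction x using Fin.lastCases with
  | last => simp [lowerNbrs]
  | cast x => simp [lowerNbrs, Fin.castSucc_lt_last]

lemma numLowerNbrs_addLast (H : SimpleGraph (Fin n)) (s : Finset (Fin n)) :
    numLowerNbrs (addLast H s) = numLowerNbrs H + s.card := by
  simp [numLowerNbrs, Fin.sum_univ_castSucc, lowerNbrs_addLast_castSucc, lowerNbrs_addLast_last,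
    Set.ncard_image_of_injective _ (Fin.castSucc_injective n), Set.ncard_coe_finset]

/-- The sets of vertices to which a new last vertex may be joined. -/
def IsAttachable (H : SimpleGraph (Fin n)) (s : Finset (Fin n)) : Prop :=
  H.IsNClique 1 s ∨ H.IsNClique 2 s

lemma isAttachable_iff (H : SimpleGraph (Fin n)) (s : Finset (Fin n)) :
    IsAttachable H s ↔ s.Nonempty ∧ s.card ≤ 2 ∧ H.IsClique s := by
  rw [IsAttachable, SimpleGraph.isNClique_iff, SimpleGraph.isNClique_iff, ← Finset.card_pos]
  constructor
  · rintro (⟨h, h'⟩ | ⟨h, h'⟩) <;> exact ⟨by omega, by omega, h⟩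
  · rintro ⟨h1, h2, h3⟩
    obtain h | h : s.card = 1 ∨ s.card = 2 := by omega
    · exact Or.inl ⟨h3, h⟩
    · exact Or.inr ⟨h3, h⟩

lemma isIncreasing12Tree_addLast (hn : 1 ≤ n) (H : SimpleGraph (Fin n)) (s : Finset (Fin n)) :
    IsIncreasing12Tree (addLast H s) ↔ IsIncreasing12Tree H ∧ IsAttachable H s := by
  rw [isAttachable_iff, IsIncreasing12Tree, Fin.forall_fin_succ']
  refine and_congr (forall_congr' fun v => ?_) ?_
  · simp [lowerNbrs_addLast_castSucc, Set.ncard_image_of_injective _ (Fin.castSucc_injective n)]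
  · simp [lowerNbrs_addLast_last, Set.ncard_image_of_injective _ (Fin.castSucc_injective n), hn,
      Set.ncard_coe_finset, SimpleGraph.IsClique, Set.Pairwise]

open Classical in
lemma card_isNClique_one (H : SimpleGraph (Fin n)) :
    (Finset.univ.filter fun s => H.IsNClique 1 s).card = n := by
  have : (Finset.univ.filter fun s => H.IsNClique 1 s) =
      Finset.powersetCard 1 (Finset.univ : Finset (Fin n)) := by
    ext s
    simp only [Finset.mem_filter, Finset.mem_univ, true_and, SimpleGraph.isNClique_one,
      Finset.mem_powersetCard, Finset.subset_univ, Finset.card_eq_one]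
  rw [this]
  simp

lemma isNClique_two_iff {V : Type*} [DecidableEq V] (G : SimpleGraph V) (s : Finset V) :
    G.IsNClique 2 s ↔ ∃ a b, G.Adj a b ∧ s = {a, b} := by
  rw [SimpleGraph.isNClique_iff, Finset.card_eq_two]
  constructor
  · rintro ⟨h, a, b, hab, rfl⟩
    exact ⟨a, b, h (by simp) (by simp) hab, rfl⟩
  · rintro ⟨a, b, hab, rfl⟩
    refine ⟨?_, a, b, hab.ne, rfl⟩
    rw [Finset.coe_pair, SimpleGraph.isClique_pair]
    exact fun _ => hab

open Classical in
lemma card_isNClique_two (H : SimpleGraph (Fin n)) :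
    (Finset.univ.filter fun s => H.IsNClique 2 s).card = numLowerNbrs H := by
  have h : numLowerNbrs H =
      (Finset.univ.sigma fun v : Fin n => Finset.univ.filter fun x => x ∈ lowerNbrs H v).card := by
    rw [Finset.card_sigma]
    refine Finset.sum_congr rfl fun v _ => ?_
    rw [← Set.ncard_coe_finset]
    simp
  rw [h]
  symm
  refine Finset.card_bij (fun p _ => {p.1, p.2}) ?_ ?_ ?_
  · rintro ⟨v, x⟩ hp
    simp only [mem_lowerNbrs, Finset.mem_sigma, Finset.mem_univ, Finset.mem_filter,
      true_and] at hp
    simp only [Finset.mem_filter, Finset.mem_univ, true_and, isNClique_two_iff]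
    exact ⟨v, x, hp.1, rfl⟩
  · rintro ⟨v, x⟩ hp ⟨w, y⟩ hq hpq
    simp only [mem_lowerNbrs, Finset.mem_sigma, Finset.mem_univ, Finset.mem_filter,
      true_and] at hp hq
    have h1 : v = w ∨ v = y := by
      have : v ∈ ({w, y} : Finset (Fin n)) := hpq ▸ Finset.mem_insert_self _ _
      simpa using this
    have h2 : x = w ∨ x = y := by
      have : x ∈ ({w, y} : Finset (Fin n)) := hpq ▸ by simp
      simpa using this
    have h3 : w = v ∨ w = x := by
      have : w ∈ ({v, x} : Finset (Fin n)) := hpq ▸ Finset.mem_insert_self _ _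
      simpa using this
    obtain ⟨rfl, rfl⟩ : v = w ∧ x = y := by omega
    rfl
  · intro s hs
    simp only [Finset.mem_filter, Finset.mem_univ, true_and, isNClique_two_iff] at hs
    obtain ⟨a, b, hab, rfl⟩ := hs
    obtain h | h := lt_or_gt_of_ne hab.ne
    · exact ⟨⟨b, a⟩, by simp [mem_lowerNbrs, hab.symm, h], Finset.pair_comm _ _⟩
    · exact ⟨⟨a, b⟩, by simp [mem_lowerNbrs, hab, h], rfl⟩

open Classical in
lemma sum_isAttachable (H : SimpleGraph (Fin n)) (φ : ℕ → ℕ) :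
    ∑ s with IsAttachable H s, φ s.card = n * φ 1 + numLowerNbrs H * φ 2 := by
  have hd : Disjoint (Finset.univ.filter fun s => H.IsNClique 1 s)
      (Finset.univ.filter fun s => H.IsNClique 2 s) := by
    rw [Finset.disjoint_filter]
    intro s _ h1 h2
    have := h1.card_eq.symm.trans h2.card_eq
    omega
  have hf : (Finset.univ.filter fun s => IsAttachable H s) =
      (Finset.univ.filter fun s => H.IsNClique 1 s) ∪
        Finset.univ.filter fun s => H.IsNClique 2 s := by
    ext s
    simp [IsAttachable]
  rw [hf, Finset.sum_union hd]
  congr 1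
  · rw [Finset.sum_congr rfl fun s hs => by rw [(Finset.mem_filter.1 hs).2.card_eq],
      Finset.sum_const, card_isNClique_one, smul_eq_mul]
  · rw [Finset.sum_congr rfl fun s hs => by rw [(Finset.mem_filter.1 hs).2.card_eq],
      Finset.sum_const, card_isNClique_two, smul_eq_mul]

open Classical in
lemma sum_numExtensions_succ (hn : 1 ≤ n) (k : ℕ) :
    ∑ G : SimpleGraph (Fin (n + 1)) with IsIncreasing12Tree G,
        numExtensions k (n + 1) (numLowerNbrs G) =
      ∑ G : SimpleGraph (Fin n) with IsIncreasing12Tree G,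
        numExtensions (k + 1) n (numLowerNbrs G) := by
  rw [Finset.sum_filter, ← (addLastEquiv n).sum_comp, Fintype.sum_prod_type, Finset.sum_filter]
  refine Finset.sum_congr rfl fun H _ => ?_
  simp only [addLastEquiv, Equiv.coe_fn_mk, isIncreasing12Tree_addLast hn, numLowerNbrs_addLast]
  by_cases hH : IsIncreasing12Tree H
  · simp only [hH, true_and, if_true]
    rw [← Finset.sum_filter,
      sum_isAttachable H fun i => numExtensions k (n + 1) (numLowerNbrs H + i), numExtensions]
  · simp [hH]

open Classical in
lemma sum_numExtensions (k m : ℕ) :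
    ∑ G : SimpleGraph (Fin (m + 1)) with IsIncreasing12Tree G,
        numExtensions k (m + 1) (numLowerNbrs G) = numExtensions (m + k) 1 0 := by
  induction m generalizing k with
  | zero =>
    have h : ∀ G : SimpleGraph (Fin 1), IsIncreasing12Tree G := fun G v hv => by omega
    have h0 : ∀ G : SimpleGraph (Fin 1), numLowerNbrs G = 0 := fun G => by
      have : lowerNbrs G 0 = ∅ := by
        ext x
        simp [lowerNbrs]
      simp [numLowerNbrs, this]
    simp [h, h0]
  | succ m ih =>
    rw [sum_numExtensions_succ (by omega), ih]
    congr 1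
    omega

/-- The number of increasing 1,2-trees, in a form free of subtraction. -/
theorem card_increasing12Trees_mul (m : ℕ) :
    Nat.card {G : SimpleGraph (Fin (m + 1)) // IsIncreasing12Tree G} * (m + 1) =
      (m + 1) ^ m := by
  classical
  have h := sum_numExtensions 0 m
  simp only [numExtensions, Finset.sum_const, smul_eq_mul, mul_one, add_zero] at h
  rw [← numExtensions_one_zero_mul, ← h, Nat.card_eq_fintype_card, Fintype.card_subtype]

end IncreasingTrees

/-- For every `n ≥ 1`, the number of increasing 1,2-trees on `{1,…,n}` equals the number of
labeled (Cayley) trees on `{1,…,n}`. -/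
theorem card_increasing12Trees_eq_card_trees (n : ℕ) (hn : 1 ≤ n) :
    Nat.card {G : SimpleGraph (Fin n) // IsIncreasing12Tree G} =
      Nat.card {G : SimpleGraph (Fin n) // G.IsTree} := by
  obtain ⟨m, rfl⟩ : ∃ m, n = m + 1 := ⟨n - 1, by omega⟩
  have h := card_trees_mul_card (V := Fin (m + 1))
  rw [Fintype.card_fin, Nat.add_sub_cancel, ← card_increasing12Trees_mul] at h
  exact (Nat.eq_of_mul_eq_mul_right m.succ_pos h).symm
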